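/- Every brick-directed finite-dimensional algebra is weakly triangular: the only oriented cycles in its Ext-quiver are powers and compositions of loops. -/

import Mathlib

open Function

def IsBrick (A : Type) [Ring A] (M : ModuleCat.{0} A) : Prop :=
  Nontrivial M ∧ ∀ f : M →ₗ[A] M, f ≠ 0 → Function.Bijective f

/-- `mod A` contains a brick-cycle: a sequence of nonzero non-invertible homomorphisms
`X₀ → X₁ → ⋯ → X_m` (`m ≥ 1`) between bricks with `X₀ ≅ X_m`. -/
def HasBrickCycle (A : Type) [Ring A] : Prop :=
  ∃ (m : ℕ) (X : ℕ → ModuleCat.{0} A) (f : ∀ i : ℕ, X i →ₗ[A] X (i + 1)),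
    1 ≤ m ∧ (∀ i ≤ m, Module.Finite A (X i) ∧ IsBrick A (X i)) ∧
    (∀ i < m, f i ≠ 0 ∧ ¬ Function.Bijective (f i)) ∧
    Nonempty (X 0 ≃ₗ[A] X m)

/-- `A` is brick-directed if `mod A` contains no brick-cycle. -/
def BrickDirected (A : Type) [Ring A] : Prop := ¬ HasBrickCycle A

/-- `Ext^1_A(X, Y) ≠ 0`: there is a non-split short exact sequence `0 → Y → E → X → 0`. -/
def ExtNonvanishing (A : Type) [Ring A] (X Y : ModuleCat.{0} A) : Prop :=
  ∃ (E : ModuleCat.{0} A) (i : Y →ₗ[A] E) (p : E →ₗ[A] X),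
    Function.Injective i ∧ Function.Surjective p ∧ Function.Exact i p ∧
    ∀ s : X →ₗ[A] E, p ∘ₗ s ≠ LinearMap.id

/-- `A` is weakly triangular: the only oriented cycles in the Ext-quiver of `A`
are powers and compositions of loops, i.e. every cycle of simple modules along
nonvanishing `Ext^1` stays at a single vertex. -/
def WeaklyTriangular (A : Type) [Ring A] : Prop :=
  ∀ (m : ℕ) (U : ℕ → ModuleCat.{0} A),
    (∀ i ≤ m, Module.Finite A (U i) ∧ IsSimpleModule A (U i)) →
    (∀ i < m, ExtNonvanishing A (U i) (U (i + 1))) →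
    Nonempty (U 0 ≃ₗ[A] U m) →
    ∀ i ≤ m, Nonempty (U i ≃ₗ[A] U 0)

def BRel (A : Type) [Ring A] (X Y : ModuleCat.{0} A) : Prop :=
  (Module.Finite A X ∧ IsBrick A X) ∧ (Module.Finite A Y ∧ IsBrick A Y) ∧
    ∃ f : X →ₗ[A] Y, f ≠ 0 ∧ ¬ Function.Bijective f

theorem transGen_seq {α : Type*} {r : α → α → Prop} {x y : α} (h : Relation.TransGen r x y) :
    ∃ (m : ℕ) (X : ℕ → α), 1 ≤ m ∧ X 0 = x ∧ X m = y ∧ ∀ i < m, r (X i) (X (i + 1)) := by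
  induction h using Relation.TransGen.head_induction_on with
  | single h =>
    rename_i a
    refine ⟨1, fun n => Nat.casesOn n a (fun _ => y), le_rfl, rfl, rfl, ?_⟩
    intro i hi
    obtain rfl : i = 0 := by omega
    exact h
  | head h _ ih =>
    rename_i a c _
    obtain ⟨m, X, hm, h0, hy, hr⟩ := ih
    refine ⟨m + 1, fun n => Nat.casesOn n a X, by omega, rfl, hy, ?_⟩
    rintro (_ | i) hi
    · show r a (X 0)
      rw [h0]; exact h
    · exact hr i (by omega)

theorem cycle_of_transGen {A : Type} [Ring A] {x : ModuleCat.{0} A}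
    (h : Relation.TransGen (BRel A) x x) : HasBrickCycle A := by
  classical
  obtain ⟨m, X, hm, h0, hy, hr⟩ := transGen_seq h
  refine ⟨m, X, fun i => if h : BRel A (X i) (X (i + 1)) then h.2.2.choose else 0, hm, ?_, ?_, ?_⟩
  · intro i hi
    rcases Nat.lt_or_ge i m with h | h
    · exact (hr i h).1
    · obtain rfl : i = m := by omega
      rw [hy, ← h0]
      exact (hr 0 (by omega)).1
  · intro i hi
    have := hr i hi
    simp only [dif_pos this]
    exact this.2.2.choose_spec
  · rw [h0, hy]; exact ⟨LinearEquiv.refl A x⟩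

theorem brick_of_equiv {A : Type} [Ring A] {X Y : ModuleCat.{0} A} (e : X ≃ₗ[A] Y)
    (h : Module.Finite A X ∧ IsBrick A X) : Module.Finite A Y ∧ IsBrick A Y := by
  obtain ⟨h1, h2, h3⟩ := h
  refine ⟨Module.Finite.equiv e, ?_, ?_⟩
  · exact e.toEquiv.nontrivial_congr.1 h2
  · intro f hf
    have := h3 (e.symm.toLinearMap ∘ₗ f ∘ₗ e.toLinearMap) (by
      intro h
      apply hf
      ext y
      have := LinearMap.congr_fun h (e.symm y)
      simpa using this)
    have h4 : (f : Y → Y) = e ∘ (e.symm.toLinearMap ∘ₗ f ∘ₗ e.toLinearMap) ∘ e.symm := by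
      funext y; simp
    rw [h4]
    exact e.bijective.comp (this.comp e.symm.bijective)

theorem BRel.left {A : Type} [Ring A] {X X' Y : ModuleCat.{0} A} (e : X' ≃ₗ[A] X)
    (h : BRel A X Y) : BRel A X' Y := by
  obtain ⟨h1, h2, f, hf, hb⟩ := h
  refine ⟨brick_of_equiv e.symm h1, h2, f ∘ₗ e.toLinearMap, ?_, ?_⟩
  · intro h
    apply hf
    ext y
    have := LinearMap.congr_fun h (e.symm y)
    simpa using this
  · intro h
    apply hb
    have h4 : (f : X → Y) = (f ∘ₗ e.toLinearMap) ∘ e.symm := by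
      funext y; simp
    rw [h4]
    exact h.comp e.symm.bijective

theorem BRel.right {A : Type} [Ring A] {X Y Y' : ModuleCat.{0} A} (e : Y ≃ₗ[A] Y')
    (h : BRel A X Y) : BRel A X Y' := by
  obtain ⟨h1, h2, f, hf, hb⟩ := h
  refine ⟨h1, brick_of_equiv e h2, e.toLinearMap ∘ₗ f, ?_, ?_⟩
  · intro h
    apply hf
    ext y
    have := LinearMap.congr_fun h y
    simpa using this
  · intro h
    apply hb
    have h4 : (f : X → Y) = e.symm ∘ (e.toLinearMap ∘ₗ f) := by
      funext y; simp
    rw [h4]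
    exact e.symm.bijective.comp h

theorem transGen_left {A : Type} [Ring A] {X X' Y : ModuleCat.{0} A} (e : X' ≃ₗ[A] X)
    (h : Relation.TransGen (BRel A) X Y) : Relation.TransGen (BRel A) X' Y := by
  rcases Relation.TransGen.head'_iff.1 h with ⟨c, h1, h2⟩
  exact Relation.TransGen.head' (h1.left e) h2

theorem simple_brick {A : Type} [Ring A] {X : ModuleCat.{0} A}
    (h : Module.Finite A X ∧ IsSimpleModule A X) : Module.Finite A X ∧ IsBrick A X := by
  obtain ⟨h1, h2⟩ := h
  exact ⟨h1, IsSimpleModule.nontrivial A X, fun f hf => LinearMap.bijective_of_ne_zero hf⟩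

theorem ext_path {A : Type} [Ring A] {S T : ModuleCat.{0} A}
    (hS : Module.Finite A S ∧ IsSimpleModule A S) (hT : Module.Finite A T ∧ IsSimpleModule A T)
    (hne : ¬ Nonempty (T ≃ₗ[A] S)) (hext : ExtNonvanishing A S T) :
    ∃ E, BRel A T E ∧ BRel A E S := by
  obtain ⟨E, i, p, hi, hp, hex, hs⟩ := hext
  have bS := simple_brick hS
  have bT := simple_brick hT
  obtain ⟨fS, sS⟩ := hS
  obtain ⟨fT, sT⟩ := hT
  have nS := bS.2.1
  have nT := bT.2.1
  have hpi : ∀ t, p (i t) = 0 := fun t => (hex (i t)).2 ⟨t, rfl⟩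
  have hp0 : p ≠ 0 := by
    rintro rfl
    obtain ⟨s, hs⟩ := exists_ne (0 : S)
    obtain ⟨e, he⟩ := hp s
    exact hs (by simpa using he.symm)
  have hi0 : i ≠ 0 := by
    rintro rfl
    obtain ⟨s, hs⟩ := exists_ne (0 : T)
    exact hs (hi (by simp))
  have hinb : ¬ Function.Bijective i := by
    intro h
    apply hp0
    ext e
    obtain ⟨t, rfl⟩ := h.2 e
    simpa using hpi t
  have hpnb : ¬ Function.Bijective p := by
    intro h
    apply hi0
    ext t
    apply h.1
    simpa using hpi t
  have hker : LinearMap.ker p = LinearMap.range i := LinearMap.exact_iff.1 hex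
  -- every nonzero submodule contains the range of i
  have key : ∀ N : Submodule A E, N ≠ ⊥ → LinearMap.range i ≤ N := by
    intro N hN
    rcases eq_bot_or_eq_top (N.comap i) with h | h
    · exfalso
      have hinj : Function.Injective (p ∘ₗ N.subtype) := by
        rw [← LinearMap.ker_eq_bot, LinearMap.ker_eq_bot']
        rintro ⟨n, hn⟩ h0
        obtain ⟨t, rfl⟩ := (hex n).1 h0
        have : t ∈ N.comap i := hn
        rw [h] at this
        have : t = 0 := this
        simp [this]
      have hsurj : Function.Surjective (p ∘ₗ N.subtype) := by
        rw [← LinearMap.range_eq_top]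
        rcases eq_bot_or_eq_top (LinearMap.range (p ∘ₗ N.subtype)) with h' | h'
        · exfalso
          apply hN
          rw [eq_bot_iff]
          intro n hn
          rw [LinearMap.range_eq_bot] at h'
          have h2 : (⟨n, hn⟩ : N) = 0 := hinj (by rw [h']; rfl)
          simpa using congrArg Subtype.val h2
        · exact h'
      let e := LinearEquiv.ofBijective _ ⟨hinj, hsurj⟩
      apply hs (N.subtype ∘ₗ e.symm.toLinearMap)
      ext s
      exact e.apply_symm_apply s
    · rintro _ ⟨t, rfl⟩
      have : t ∈ N.comap i := by rw [h]; trivial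
      exact this
  have hfin : Module.Finite A E := by
    have : Module.Finite A (LinearMap.range i) := inferInstance
    have e : (E ⧸ LinearMap.range i) ≃ₗ[A] S :=
      (Submodule.quotEquivOfEq _ _ hker.symm).trans (p.quotKerEquivOfSurjective hp)
    have : Module.Finite A (E ⧸ LinearMap.range i) := Module.Finite.equiv e.symm
    exact Module.Finite.of_submodule_quotient (LinearMap.range i)
  have hart : IsArtinian A E :=
    isArtinian_of_range_eq_ker i p hker.symm
  have bE : Module.Finite A E ∧ IsBrick A E := by
    refine ⟨hfin, hi.nontrivial, ?_⟩
    intro f hf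
    by_cases hk : LinearMap.ker f = ⊥
    · exact IsArtinian.bijective_of_injective_endomorphism f (LinearMap.ker_eq_bot.1 hk)
    · exfalso
      have h1 := key _ hk
      have hr : LinearMap.range f ≠ ⊥ := by rwa [Ne, LinearMap.range_eq_bot]
      have h2 := key _ hr
      -- the induced map S → E
      let g : S →ₗ[A] E := (Submodule.liftQ (LinearMap.ker p) f (by rw [hker]; exact h1)) ∘ₗ
        (p.quotKerEquivOfSurjective hp).symm.toLinearMap
      have hg : ∀ e, g (p e) = f e := by
        intro e
        have : (p.quotKerEquivOfSurjective hp).symm (p e) = Submodule.Quotient.mk e := by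
          rw [LinearEquiv.symm_apply_eq]; rfl
        show Submodule.liftQ _ f (by rw [hker]; exact h1) ((p.quotKerEquivOfSurjective hp).symm (p e)) = f e
        rw [this]; rfl
      -- range i ≤ range g, so the preimage in S is nonzero, hence everything
      have hc : (LinearMap.range i).comap g = ⊤ := by
        rcases eq_bot_or_eq_top ((LinearMap.range i).comap g) with h | h
        · exfalso
          apply hi0
          ext t
          obtain ⟨e, he⟩ := h2 ⟨t, rfl⟩
          have : p e ∈ (LinearMap.range i).comap g := ⟨t, by rw [hg, he]⟩
          rw [h] at this
          have h0 : p e = 0 := this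
          have := hg e
          rw [h0, map_zero, he] at this
          simpa using this.symm
        · exact h
      have hpf : ∀ s, g s ∈ LinearMap.range i := fun s => by
        have : s ∈ (LinearMap.range i).comap g := by rw [hc]; trivial
        exact this
      let e := LinearEquiv.ofInjective i hi
      let q : S →ₗ[A] T := e.symm.toLinearMap ∘ₗ g.codRestrict _ hpf
      have hq : q ≠ 0 := by
        intro h
        apply hf
        ext x
        have h3 := LinearMap.congr_fun h (p x)
        have h4 : g.codRestrict _ hpf (p x) = 0 := by
          apply e.symm.injective
          simpa [q] using h3
        have h5 := congrArg Subtype.val h4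
        rw [← hg]
        simpa using h5
      exact hne ⟨(LinearEquiv.ofBijective q (LinearMap.bijective_of_ne_zero hq)).symm⟩
  exact ⟨E, ⟨bT, bE, i, hi0, hinb⟩, ⟨bE, bS, p, hp0, hpnb⟩⟩

theorem stmt12 (k A : Type) [Field k] [Ring A] [Algebra k A] [FiniteDimensional k A]
    (hbd : BrickDirected A) : WeaklyTriangular A := by
  intro m U hU hE hiso
  have P : ∀ i ≤ m, (∀ j ≤ i, Nonempty (U j ≃ₗ[A] U 0)) ∨
      Relation.TransGen (BRel A) (U i) (U 0) := by
    intro i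
    induction i with
    | zero =>
      intro _
      left
      intro j hj
      obtain rfl : j = 0 := by omega
      exact ⟨LinearEquiv.refl A _⟩
    | succ i ih =>
      intro hi
      by_cases hc : Nonempty (U (i + 1) ≃ₗ[A] U i)
      · obtain ⟨e⟩ := hc
        rcases ih (by omega) with h | h
        · left
          intro j hj
          rcases Nat.lt_or_ge i j with h' | h'
          · obtain rfl : j = i + 1 := by omega
            obtain ⟨e'⟩ := h i le_rfl
            exact ⟨e.trans e'⟩
          · exact h j h'
        · exact Or.inr (transGen_left e h)
      · right
        obtain ⟨E, h1, h2⟩ := ext_path (hU i (by omega)) (hU (i + 1) hi) hc (hE i (by omega))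
        rcases ih (by omega) with h | h
        · obtain ⟨e'⟩ := h i le_rfl
          exact Relation.TransGen.head h1 (Relation.TransGen.single (h2.right e'))
        · exact Relation.TransGen.head h1 (Relation.TransGen.head h2 h)
  rcases P m le_rfl with h | h
  · exact h
  · obtain ⟨e⟩ := hiso
    exact absurd (cycle_of_transGen (transGen_left e h)) hbd
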